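/- For the metric g_n = (dφ₁² + dφ₂²)/n + n² dt² on T² × (0,2π), the possible curl eigenvalues λ satisfy λ² = n m₁² + n m₂² + m²/(4n²) for some (m₁, m₂, m) ∈ ℕ³, coming from separation of variables; in particular if (m₁, m₂) ≠ (0,0) then |λ| ≥ 1. -/

import Mathlib

open Real

/-- A continuous function with equal values at the ends of a period is determined by its
sine and cosine moments. -/
lemma eq_zero_of_trig_moments_eq_zero {a T : ℝ} (hT : 0 < T) {f : ℝ → ℝ} (hf : Continuous f)
    (hper : f a = f (a + T))
    (hcos : ∀ k : ℤ, ∫ s in a..a + T, cos (2 * π * k / T * s) * f s = 0)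
    (hsin : ∀ k : ℤ, ∫ s in a..a + T, sin (2 * π * k / T * s) * f s = 0)
    {x : ℝ} (hx : x ∈ Set.Ico a (a + T)) : f x = 0 := by
  have : Fact (0 < T) := ⟨hT⟩
  let g : ℝ → ℂ := fun s => (f s : ℂ)
  have hg : Continuous g := Complex.continuous_ofReal.comp hf
  let F : C(AddCircle T, ℂ) :=
    ⟨AddCircle.liftIco T a g, AddCircle.liftIco_continuous (by simp [g, hper]) hg.continuousOn⟩
  have hcoef : ∀ k : ℤ, fourierCoeff F k = 0 := by
    intro k
    change fourierCoeff (AddCircle.liftIco T a g) k = 0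
    rw [fourierCoeff_liftIco_eq, fourierCoeffOn_eq_integral]
    have h : ∀ s : ℝ, fourier (-k) (s : AddCircle (a + T - a)) • g s
        = ((cos (2 * π * k / T * s) * f s : ℝ) : ℂ)
          - ((sin (2 * π * k / T * s) * f s : ℝ) : ℂ) * Complex.I := by
      intro s
      rw [fourier_coe_apply, smul_eq_mul]
      have : (2 * π * Complex.I * ((-k : ℤ) : ℂ) * s / ((a + T - a : ℝ) : ℂ))
          = ((-(2 * π * k / T * s) : ℝ) : ℂ) * Complex.I := by
        rw [add_sub_cancel_left]
        push_cast
        ring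
      rw [this, Complex.exp_mul_I, ← Complex.ofReal_cos, ← Complex.ofReal_sin, cos_neg, sin_neg]
      simp only [g]
      push_cast
      ring
    simp_rw [h]
    rw [intervalIntegral.integral_sub, intervalIntegral.integral_mul_const,
      intervalIntegral.integral_ofReal, intervalIntegral.integral_ofReal, hcos, hsin]
    · simp
    · exact Continuous.intervalIntegrable (by fun_prop) _ _
    · exact Continuous.intervalIntegrable (by fun_prop) _ _
  have hsum : Summable (fourierCoeff F) := by
    have : fourierCoeff F = 0 := funext hcoef
    rw [this]
    exact summable_zero
  have h := has_pointwise_sum_fourier_series_of_summable hsum (x : AddCircle T)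
  simp only [hcoef, zero_smul] at h
  have h0 : F x = 0 := h.unique hasSum_zero
  have h1 : AddCircle.liftIco T a g x = 0 := h0
  rw [AddCircle.liftIco_coe_apply hx] at h1
  exact Complex.ofReal_eq_zero.mp h1

/-- A nonzero continuous `2π`-periodic function has a nonzero trigonometric moment. -/
lemma exists_trig_moment_ne_zero {f : ℝ → ℝ} (hf : Continuous f)
    (hper : Function.Periodic f (2 * π)) {x : ℝ} (hx : f x ≠ 0) :
    ∃ (k : ℤ) (θ : ℝ), ∫ s in 0..2 * π, cos (k * s + θ) * f s ≠ 0 := by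
  by_contra! h
  obtain ⟨y, hy, hxy⟩ := hper.exists_mem_Ico₀ two_pi_pos x
  rw [hxy] at hx
  have hfreq : ∀ k : ℤ, 2 * π * k / (2 * π) = (k : ℝ) := fun k => by
    field_simp
  refine hx (eq_zero_of_trig_moments_eq_zero (a := 0) two_pi_pos hf (hper 0).symm ?_ ?_
    (by simpa using hy))
  · intro k
    simpa [hfreq] using h k 0
  · intro k
    have := h k (-(π / 2))
    simp only [← sub_eq_add_neg, cos_sub_pi_div_two] at this
    simpa [hfreq] using this

/-- A nonzero continuous function on `[0, 2π]` vanishing at the ends has a nonzero sine moment. -/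
lemma exists_sine_moment_ne_zero {f : ℝ → ℝ} (hf : Continuous f) (h0 : f 0 = 0)
    (h1 : f (2 * π) = 0) {x : ℝ} (hx : x ∈ Set.Icc 0 (2 * π)) (hfx : f x ≠ 0) :
    ∃ k : ℤ, ∫ s in 0..2 * π, sin (k / 2 * s) * f s ≠ 0 := by
  by_contra! h
  have hpi := two_pi_pos
  let g : ℝ → ℝ := fun s => f (max s 0) - f (max (-s) 0)
  have hg : Continuous g := by fun_prop
  have hodd : ∀ s, g (-s) = -g s := fun s => by simp [g]
  have hpos : ∀ s, 0 ≤ s → g s = f s := fun s hs => by simp [g, hs, h0]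
  have hend : -(2 * π) + 4 * π = 2 * π := by ring
  have hfreq : ∀ k : ℤ, 2 * π * k / (4 * π) = (k : ℝ) / 2 := fun k => by
    field_simp
    ring
  have hx' : x < 2 * π := lt_of_le_of_ne hx.2 (by rintro rfl; exact hfx h1)
  rw [← hpos x hx.1] at hfx
  refine hfx (eq_zero_of_trig_moments_eq_zero (a := -(2 * π)) (T := 4 * π) (by positivity) hg
    ?_ ?_ ?_ ⟨by linarith [hx.1], by rwa [hend]⟩)
  · rw [hend, hodd, hpos _ hpi.le, h1, neg_zero]
  · intro k
    rw [hend, hfreq]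
    have := intervalIntegral.integral_comp_neg (a := -(2 * π)) (b := 2 * π)
      (fun s => cos (k / 2 * s) * g s)
    simp only [hodd, mul_neg, cos_neg, neg_neg, intervalIntegral.integral_neg] at this
    linarith
  · intro k
    rw [hend, hfreq]
    have hint : ∀ a b, IntervalIntegrable (fun s => sin (k / 2 * s) * g s)
        MeasureTheory.volume a b := fun a b => Continuous.intervalIntegrable (by fun_prop) _ _
    have hright : ∫ s in 0..2 * π, sin (k / 2 * s) * g s = 0 := by
      refine Eq.trans ?_ (h k)
      refine intervalIntegral.integral_congr fun s hs => ?_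
      rw [Set.uIcc_of_le hpi.le] at hs
      simp only [hpos s hs.1]
    have hleft := intervalIntegral.integral_comp_neg (a := 0) (b := 2 * π)
      (fun s => sin (k / 2 * s) * g s)
    simp only [hodd, mul_neg, sin_neg, neg_mul, neg_neg, neg_zero] at hleft
    rw [← intervalIntegral.integral_add_adjacent_intervals (hint _ 0) (hint 0 _), ← hleft, hright,
      add_zero]

/-- Green's identity against an eigenfunction `u'' = -κ u`. -/
lemma integral_mul_second_deriv {u u' f f' f'' : ℝ → ℝ} {κ a b : ℝ}
    (hu : ∀ s, HasDerivAt u (u' s) s) (hu' : ∀ s, HasDerivAt u' (-κ * u s) s)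
    (hf : ∀ s, HasDerivAt f (f' s) s) (hf' : ∀ s, HasDerivAt f' (f'' s) s)
    (hcont : Continuous f'')
    (hbdry : u b * f' b - u' b * f b = u a * f' a - u' a * f a) :
    ∫ s in a..b, u s * f'' s = -κ * ∫ s in a..b, u s * f s := by
  have hcu : Continuous u := continuous_iff_continuousAt.2 fun s => (hu s).continuousAt
  have hcf : Continuous f := continuous_iff_continuousAt.2 fun s => (hf s).continuousAt
  have hD : ∀ s, HasDerivAt (fun s => u s * f' s - u' s * f s)
      (u s * f'' s + κ * (u s * f s)) s := fun s => by
    exact (((hu s).mul (hf' s)).sub ((hu' s).mul (hf s))).congr_deriv (by ring)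
  have h := intervalIntegral.integral_eq_sub_of_hasDerivAt (fun s _ => hD s)
    (Continuous.intervalIntegrable (by fun_prop) a b)
  rw [hbdry, sub_self, intervalIntegral.integral_add
    (Continuous.intervalIntegrable (by fun_prop) _ _)
    (Continuous.intervalIntegrable (by fun_prop) _ _), intervalIntegral.integral_const_mul] at h
  linarith

lemma hasDerivAt_cos_affine (k θ s : ℝ) :
    HasDerivAt (fun s => cos (k * s + θ)) (-k * sin (k * s + θ)) s := by
  have h : HasDerivAt (fun s => k * s + θ) k s := by
    simpa using ((hasDerivAt_id s).const_mul k).add_const θ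
  convert h.cos using 1
  ring

lemma hasDerivAt_sin_affine (k θ s : ℝ) :
    HasDerivAt (fun s => sin (k * s + θ)) (k * cos (k * s + θ)) s := by
  have h : HasDerivAt (fun s => k * s + θ) k s := by
    simpa using ((hasDerivAt_id s).const_mul k).add_const θ
  convert h.sin using 1
  ring

/-- Trigonometric moments of the second derivative of a `2π`-periodic function. -/
lemma integral_cos_mul_second_deriv {f f' f'' : ℝ → ℝ} (k : ℤ) (θ : ℝ)
    (hf : ∀ s, HasDerivAt f (f' s) s) (hf' : ∀ s, HasDerivAt f' (f'' s) s)
    (hcont : Continuous f'') (hper : Function.Periodic f (2 * π)) :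
    ∫ s in 0..2 * π, cos (k * s + θ) * f'' s
      = -(k : ℝ) ^ 2 * ∫ s in 0..2 * π, cos (k * s + θ) * f s := by
  have hper' : f' (2 * π) = f' 0 := by
    have h := (hf (0 + 2 * π)).comp_add_const 0 (2 * π)
    rw [funext hper, zero_add] at h
    exact h.unique (hf 0)
  have hc : cos (k * (2 * π) + θ) = cos θ := by rw [add_comm, cos_add_int_mul_two_pi]
  have hs : sin (k * (2 * π) + θ) = sin θ := by rw [add_comm, sin_add_int_mul_two_pi]
  have hf0 : f (2 * π) = f 0 := by simpa using hper 0
  refine integral_mul_second_deriv (hasDerivAt_cos_affine k θ) (fun s => ?_) hf hf' hcont ?_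
  · exact ((hasDerivAt_sin_affine k θ s).const_mul (-(k : ℝ))).congr_deriv (by ring)
  · simp only [hc, hs, hper', hf0, mul_zero, zero_add]

/-- Sine moments of the second derivative of a function vanishing at `0` and `2π`. -/
lemma integral_sin_mul_second_deriv {f f' f'' : ℝ → ℝ} (k : ℤ)
    (hf : ∀ s, HasDerivAt f (f' s) s) (hf' : ∀ s, HasDerivAt f' (f'' s) s)
    (hcont : Continuous f'') (h0 : f 0 = 0) (h1 : f (2 * π) = 0) :
    ∫ s in 0..2 * π, sin (k / 2 * s) * f'' s
      = -((k : ℝ) / 2) ^ 2 * ∫ s in 0..2 * π, sin (k / 2 * s) * f s := by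
  refine integral_mul_second_deriv (u' := fun s => k / 2 * cos (k / 2 * s)) (fun s => ?_)
    (fun s => ?_) hf hf' hcont ?_
  · simpa using hasDerivAt_sin_affine (k / 2) 0 s
  · have h := (hasDerivAt_cos_affine (k / 2) 0 s).const_mul ((k : ℝ) / 2)
    simp only [add_zero] at h
    exact h.congr_deriv (by ring)
  · have : sin ((k : ℝ) / 2 * (2 * π)) = 0 := by
      rw [show (k : ℝ) / 2 * (2 * π) = k * π by ring]
      exact sin_int_mul_pi k
    simp [this, h0, h1]

/-- Integral over the cube `[0, 2π]³`. -/
noncomputable def cubeIntegral (F : ℝ → ℝ → ℝ → ℝ) : ℝ :=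
  ∫ t in 0..2 * π, ∫ y in 0..2 * π, ∫ x in 0..2 * π, F x y t

lemma continuous_integral_fst {F : ℝ → ℝ → ℝ → ℝ}
    (hF : Continuous fun p : ℝ × ℝ × ℝ => F p.1 p.2.1 p.2.2) :
    Continuous fun q : ℝ × ℝ => ∫ x in 0..2 * π, F x q.1 q.2 :=
  intervalIntegral.continuous_parametric_intervalIntegral_of_continuous'
    (f := fun (q : ℝ × ℝ) x => F x q.1 q.2)
    (hF.comp (by fun_prop : Continuous fun z : (ℝ × ℝ) × ℝ => (z.2, z.1.1, z.1.2))) _ _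

lemma continuous_integral_fst_snd {F : ℝ → ℝ → ℝ → ℝ}
    (hF : Continuous fun p : ℝ × ℝ × ℝ => F p.1 p.2.1 p.2.2) :
    Continuous fun t : ℝ => ∫ y in 0..2 * π, ∫ x in 0..2 * π, F x y t :=
  intervalIntegral.continuous_parametric_intervalIntegral_of_continuous'
    (f := fun t y => ∫ x in 0..2 * π, F x y t)
    ((continuous_integral_fst hF).comp continuous_swap) _ _

lemma integral_swap_of_continuous {G : ℝ → ℝ → ℝ} (hG : Continuous G.uncurry) (a b c d : ℝ) :
    ∫ x in a..b, ∫ y in c..d, G x y = ∫ y in c..d, ∫ x in a..b, G x y :=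
  MeasureTheory.intervalIntegral_intervalIntegral_swap <|
    (hG.continuousOn.integrableOn_compact (isCompact_uIcc.prod isCompact_uIcc)).mono_set
      (Set.prod_mono Set.uIoc_subset_uIcc Set.uIoc_subset_uIcc)

lemma cubeIntegral_eq_snd {F : ℝ → ℝ → ℝ → ℝ}
    (hF : Continuous fun p : ℝ × ℝ × ℝ => F p.1 p.2.1 p.2.2) :
    cubeIntegral F = ∫ t in 0..2 * π, ∫ x in 0..2 * π, ∫ y in 0..2 * π, F x y t := by
  unfold cubeIntegral
  congr 1
  funext t
  exact integral_swap_of_continuous (G := fun y x => F x y t)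
    (hF.comp (by fun_prop : Continuous fun z : ℝ × ℝ => (z.2, z.1, t))) _ _ _ _

lemma cubeIntegral_eq_trd {F : ℝ → ℝ → ℝ → ℝ}
    (hF : Continuous fun p : ℝ × ℝ × ℝ => F p.1 p.2.1 p.2.2) :
    cubeIntegral F = ∫ y in 0..2 * π, ∫ x in 0..2 * π, ∫ t in 0..2 * π, F x y t := by
  unfold cubeIntegral
  rw [integral_swap_of_continuous (G := fun t y => ∫ x in 0..2 * π, F x y t)
    ((continuous_integral_fst hF).comp continuous_swap)]
  congr 1
  funext y
  exact integral_swap_of_continuous (G := fun t x => F x y t)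
    (hF.comp (by fun_prop : Continuous fun z : ℝ × ℝ => (z.2, y, z.1))) _ _ _ _

lemma cubeIntegral_const_mul (c : ℝ) (F : ℝ → ℝ → ℝ → ℝ) :
    cubeIntegral (fun x y t => c * F x y t) = c * cubeIntegral F := by
  simp only [cubeIntegral, intervalIntegral.integral_const_mul]

lemma cubeIntegral_add {F G : ℝ → ℝ → ℝ → ℝ}
    (hF : Continuous fun p : ℝ × ℝ × ℝ => F p.1 p.2.1 p.2.2)
    (hG : Continuous fun p : ℝ × ℝ × ℝ => G p.1 p.2.1 p.2.2) :
    cubeIntegral (fun x y t => F x y t + G x y t) = cubeIntegral F + cubeIntegral G := by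
  have h1 : ∀ y t, ∫ x in 0..2 * π, F x y t + G x y t
      = (∫ x in 0..2 * π, F x y t) + ∫ x in 0..2 * π, G x y t := fun y t =>
    intervalIntegral.integral_add
      ((hF.comp (by fun_prop : Continuous fun x : ℝ => (x, y, t))).intervalIntegrable _ _)
      ((hG.comp (by fun_prop : Continuous fun x : ℝ => (x, y, t))).intervalIntegrable _ _)
  have h2 : ∀ t, (∫ y in 0..2 * π, ((∫ x in 0..2 * π, F x y t) + ∫ x in 0..2 * π, G x y t))
      = (∫ y in 0..2 * π, ∫ x in 0..2 * π, F x y t)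
        + ∫ y in 0..2 * π, ∫ x in 0..2 * π, G x y t := fun t =>
    intervalIntegral.integral_add
      (((continuous_integral_fst hF).comp
        (by fun_prop : Continuous fun y : ℝ => (y, t))).intervalIntegrable _ _)
      (((continuous_integral_fst hG).comp
        (by fun_prop : Continuous fun y : ℝ => (y, t))).intervalIntegrable _ _)
  simp only [cubeIntegral, h1, h2]
  exact intervalIntegral.integral_add
    ((continuous_integral_fst_snd hF).intervalIntegrable _ _)
    ((continuous_integral_fst_snd hG).intervalIntegrable _ _)

/-- The second directional derivative along `e`, as iterated Fréchet derivative. -/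
lemma exists_second_directional_deriv {E : Type*} [NormedAddCommGroup E] [NormedSpace ℝ E]
    {V : E → ℝ} (hV : ContDiff ℝ (⊤ : ℕ∞) V) (e : E) :
    ∃ V₁ V₂ : E → ℝ, Continuous V₂ ∧
      ∀ (c : ℝ → E), (∀ s, HasDerivAt c e s) →
        (∀ s, HasDerivAt (fun r => V (c r)) (V₁ (c s)) s) ∧
        (∀ s, HasDerivAt (fun r => V₁ (c r)) (V₂ (c s)) s) ∧
        (∀ s, deriv (deriv fun r => V (c r)) s = V₂ (c s)) := by
  have hV₁ : ContDiff ℝ (⊤ : ℕ∞) fun p => fderiv ℝ V p e :=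
    (hV.fderiv_right (m := (⊤ : ℕ∞)) (by simp)).clm_apply contDiff_const
  have hV₂ : ContDiff ℝ (⊤ : ℕ∞) fun p => fderiv ℝ (fun p => fderiv ℝ V p e) p e :=
    (hV₁.fderiv_right (m := (⊤ : ℕ∞)) (by simp)).clm_apply contDiff_const
  refine ⟨fun p => fderiv ℝ V p e, _, hV₂.continuous, fun c hc => ?_⟩
  have h1 : ∀ s, HasDerivAt (fun r => V (c r)) (fderiv ℝ V (c s) e) s := fun s =>
    ((hV.differentiable (by simp)) (c s)).hasFDerivAt.comp_hasDerivAt s (hc s)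
  have h2 : ∀ s, HasDerivAt (fun r => fderiv ℝ V (c r) e)
      (fderiv ℝ (fun p => fderiv ℝ V p e) (c s) e) s := fun s =>
    ((hV₁.differentiable (by simp)) (c s)).hasFDerivAt.comp_hasDerivAt s (hc s)
  refine ⟨h1, h2, fun s => ?_⟩
  rw [funext fun s => (h1 s).deriv]
  exact (h2 s).deriv

/-- For the metric `g_n = (dφ₁² + dφ₂²)/n + n² dt²` on `T² × (0,2π)`, the possible curl
eigenvalues `λ` satisfy `λ² = n m₁² + n m₂² + m²/(4n²)` for some `(m₁, m₂, m) ∈ ℕ³`,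
coming from separation of variables; in particular if `(m₁, m₂) ≠ (0,0)` then `|λ| ≥ 1`.
A component `v` of an eigenfield with eigenvalue `λ ≠ 0` satisfies the PDE
`−n ∂²_{φ₁} v − n ∂²_{φ₂} v − n⁻² ∂²_t v = λ² v`, is `2π`-periodic in `φ₁, φ₂`, and
(for the third component) vanishes at `t = 0, 2π`. -/
theorem toroidal_annulus_eigenvalue_form (n : ℕ) (hn : 0 < n) (lam : ℝ)
    (v : ℝ → ℝ → ℝ → ℝ)
    (hsmooth : ContDiff ℝ (⊤ : ℕ∞) fun p : ℝ × ℝ × ℝ => v p.1 p.2.1 p.2.2)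
    (hper1 : ∀ x y t, v (x + 2 * π) y t = v x y t)
    (hper2 : ∀ x y t, v x (y + 2 * π) t = v x y t)
    (hbc : ∀ x y, v x y 0 = 0 ∧ v x y (2 * π) = 0)
    (hpde : ∀ x y t, t ∈ Set.Icc (0 : ℝ) (2 * π) →
      -(n : ℝ) * deriv (deriv fun s => v s y t) x
        - (n : ℝ) * deriv (deriv fun s => v x s t) y
        - ((n : ℝ) ^ 2)⁻¹ * deriv (deriv fun s => v x y s) t
        = lam ^ 2 * v x y t)
    (hnz : ∃ x y t, t ∈ Set.Icc (0 : ℝ) (2 * π) ∧ v x y t ≠ 0) :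
    (∃ m1 m2 m : ℕ, lam ^ 2
        = (n : ℝ) * (m1 : ℝ) ^ 2 + (n : ℝ) * (m2 : ℝ) ^ 2 + (m : ℝ) ^ 2 / (4 * (n : ℝ) ^ 2)) ∧
    (∀ m1 m2 m : ℕ, ¬(m1 = 0 ∧ m2 = 0) →
      lam ^ 2 = (n : ℝ) * (m1 : ℝ) ^ 2 + (n : ℝ) * (m2 : ℝ) ^ 2 + (m : ℝ) ^ 2 / (4 * (n : ℝ) ^ 2) →
      1 ≤ |lam|) := by
  have hn1 : (1 : ℝ) ≤ n := by exact_mod_cast hn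
  refine ⟨?_, fun m1 m2 m hm h => ?_⟩
  · have hv : Continuous fun p : ℝ × ℝ × ℝ => v p.1 p.2.1 p.2.2 := hsmooth.continuous
    obtain ⟨x₀, y₀, t₀, ht₀, hv₀⟩ := hnz
    -- successive nonzero Fourier moments in each variable
    obtain ⟨k₁, θ₁, h₁⟩ := exists_trig_moment_ne_zero
      (f := fun x => v x y₀ t₀)
      (hv.comp (by fun_prop : Continuous fun x : ℝ => (x, y₀, t₀))) (fun x => hper1 x y₀ t₀) hv₀
    have hav : Continuous fun p : ℝ × ℝ × ℝ => cos (k₁ * p.1 + θ₁) * v p.1 p.2.1 p.2.2 := by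
      fun_prop
    have hG₁ := continuous_integral_fst (F := fun x y t => cos (k₁ * x + θ₁) * v x y t) hav
    obtain ⟨k₂, θ₂, h₂⟩ := exists_trig_moment_ne_zero
      (f := fun y => ∫ x in 0..2 * π, cos (k₁ * x + θ₁) * v x y t₀)
      (hG₁.comp (by fun_prop : Continuous fun y : ℝ => (y, t₀)))
      (fun y => by simp only [hper2]) h₁
    have habv : Continuous fun p : ℝ × ℝ × ℝ =>
        cos (k₂ * p.2.1 + θ₂) * (cos (k₁ * p.1 + θ₁) * v p.1 p.2.1 p.2.2) := by
      fun_prop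
    have hG₂ := continuous_integral_fst_snd
      (F := fun x y t => cos (k₂ * y + θ₂) * (cos (k₁ * x + θ₁) * v x y t)) habv
    simp only [intervalIntegral.integral_const_mul] at hG₂
    obtain ⟨k₃, h₃⟩ := exists_sine_moment_ne_zero hG₂ (by simp [(hbc _ _).1])
      (by simp [(hbc _ _).2]) ht₀ h₂
    let w : ℝ → ℝ → ℝ → ℝ := fun x y t =>
      sin (k₃ / 2 * t) * (cos (k₂ * y + θ₂) * cos (k₁ * x + θ₁))
    have hJ : cubeIntegral (fun x y t => w x y t * v x y t) ≠ 0 := by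
      simpa only [w, cubeIntegral, mul_assoc, intervalIntegral.integral_const_mul] using h₃
    have hw : Continuous fun p : ℝ × ℝ × ℝ => w p.1 p.2.1 p.2.2 := by fun_prop
    -- moments of the second partial derivatives
    obtain ⟨X₁, X₂, hX, hXd⟩ := exists_second_directional_deriv hsmooth (1, 0, 0)
    obtain ⟨Y₁, Y₂, hY, hYd⟩ := exists_second_directional_deriv hsmooth (0, 1, 0)
    obtain ⟨Z₁, Z₂, hZ, hZd⟩ := exists_second_directional_deriv hsmooth (0, 0, 1)
    replace hXd := fun y t => hXd (fun x => (x, y, t)) fun s =>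
      (hasDerivAt_id s).prodMk ((hasDerivAt_const s y).prodMk (hasDerivAt_const s t))
    replace hYd := fun x t => hYd (fun y => (x, y, t)) fun s =>
      (hasDerivAt_const s x).prodMk ((hasDerivAt_id s).prodMk (hasDerivAt_const s t))
    replace hZd := fun x y => hZd (fun t => (x, y, t)) fun s =>
      (hasDerivAt_const s x).prodMk ((hasDerivAt_const s y).prodMk (hasDerivAt_id s))
    have hJX : cubeIntegral (fun x y t => w x y t * X₂ (x, y, t))
        = -(k₁ : ℝ) ^ 2 * cubeIntegral (fun x y t => w x y t * v x y t) := by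
      rw [← cubeIntegral_const_mul]
      have := fun y t => integral_cos_mul_second_deriv k₁ θ₁ (hXd y t).1 (hXd y t).2.1
        (by fun_prop) (fun x => hper1 x y t)
      simp only [cubeIntegral, w, mul_assoc, intervalIntegral.integral_const_mul, this]
      simp only [mul_left_comm _ (-(k₁ : ℝ) ^ 2), intervalIntegral.integral_const_mul]
    have hJY : cubeIntegral (fun x y t => w x y t * Y₂ (x, y, t))
        = -(k₂ : ℝ) ^ 2 * cubeIntegral (fun x y t => w x y t * v x y t) := by
      rw [← cubeIntegral_const_mul, cubeIntegral_eq_snd (by fun_prop),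
        cubeIntegral_eq_snd (by fun_prop)]
      have := fun x t => integral_cos_mul_second_deriv k₂ θ₂ (hYd x t).1 (hYd x t).2.1
        (by fun_prop) (fun y => hper2 x y t)
      simp only [w, mul_assoc, mul_left_comm _ (cos (k₁ * _ + θ₁)),
        intervalIntegral.integral_const_mul, this]
      simp only [mul_left_comm _ (-(k₂ : ℝ) ^ 2), intervalIntegral.integral_const_mul]
    have hJZ : cubeIntegral (fun x y t => w x y t * Z₂ (x, y, t))
        = -((k₃ : ℝ) / 2) ^ 2 * cubeIntegral (fun x y t => w x y t * v x y t) := by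
      rw [← cubeIntegral_const_mul, cubeIntegral_eq_trd (by fun_prop),
        cubeIntegral_eq_trd (by fun_prop)]
      have := fun x y => integral_sin_mul_second_deriv k₃ (hZd x y).1 (hZd x y).2.1
        (by fun_prop) (hbc x y).1 (hbc x y).2
      simp only [w, mul_assoc, mul_left_comm (sin (k₃ / 2 * _)),
        intervalIntegral.integral_const_mul, this]
      simp only [mul_left_comm _ (-((k₃ : ℝ) / 2) ^ 2), intervalIntegral.integral_const_mul]
    have hzero : cubeIntegral (fun x y t => (n * (w x y t * X₂ (x, y, t))
        + n * (w x y t * Y₂ (x, y, t))) + (((n : ℝ) ^ 2)⁻¹ * (w x y t * Z₂ (x, y, t))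
        + lam ^ 2 * (w x y t * v x y t))) = 0 := by
      unfold cubeIntegral
      refine intervalIntegral.integral_zero_ae (.of_forall fun t ht => ?_)
      rw [Set.uIoc_of_le two_pi_pos.le] at ht
      have : ∀ x y, (n * (w x y t * X₂ (x, y, t))
          + n * (w x y t * Y₂ (x, y, t))) + (((n : ℝ) ^ 2)⁻¹ * (w x y t * Z₂ (x, y, t))
          + lam ^ 2 * (w x y t * v x y t)) = 0 := fun x y => by
        have h := hpde x y t ⟨ht.1.le, ht.2⟩
        rw [(hXd y t).2.2 x, (hYd x t).2.2 y, (hZd x y).2.2 t] at h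
        linear_combination -w x y t * h
      simp [this]
    rw [cubeIntegral_add (by fun_prop) (by fun_prop), cubeIntegral_add (by fun_prop) (by fun_prop),
      cubeIntegral_add (by fun_prop) (by fun_prop)] at hzero
    simp only [cubeIntegral_const_mul, hJX, hJY, hJZ] at hzero
    refine ⟨k₁.natAbs, k₂.natAbs, k₃.natAbs, ?_⟩
    simp only [Nat.cast_natAbs, Int.cast_abs, sq_abs]
    refine mul_right_cancel₀ hJ ?_
    have : (k₃ : ℝ) ^ 2 / (4 * (n : ℝ) ^ 2) = ((n : ℝ) ^ 2)⁻¹ * (k₃ / 2) ^ 2 := by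
      field_simp
      norm_num
    rw [this]
    linear_combination hzero
  · rw [← one_le_sq_iff_one_le_abs, h]
    have hpos : 1 ≤ m1 ^ 2 + m2 ^ 2 := by
      by_contra hlt
      exact hm (by constructor <;> nlinarith)
    have hpos' : (1 : ℝ) ≤ (m1 : ℝ) ^ 2 + (m2 : ℝ) ^ 2 := by exact_mod_cast hpos
    have : 0 ≤ (m : ℝ) ^ 2 / (4 * (n : ℝ) ^ 2) := by positivity
    nlinarith
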